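/- arXiv:2505.18393 — 7 statements merged into one kernel-verified Lean document; each statement's English description precedes it below -/
import Mathlib

section
/- Let S, T, J be finite nonempty index types, let (φ_j)_{j∈J} be an orthonormal family of vectors in ℂ^S, let (χ_j)_{j∈J} be an orthonormal family in ℂ^T, let c : J → ℂ satisfy c_j ≠ 0 for every j, and let ψ ∈ ℂ^{S×T} be the vector with entries ψ(s,t) = Σ_{j∈J} c_j · φ_j(s) · χ_j(t). If Φ is a ℂ-linear map on the space of S × S complex matrices such that (Φ ⊗ id)(ψ ψᴴ) = ψ ψᴴ, then Φ(φ_j φ_kᴴ) = φ_j φ_kᴴ for all j, k ∈ J. -/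
open Matrix

noncomputable section

/-- Outer product `v wᴴ` of two vectors. -/
def outer {ι κ : Type*} (v : ι → ℂ) (w : κ → ℂ) : Matrix ι κ ℂ :=
  Matrix.of fun i j => v i * (starRingEnd ℂ) (w j)

/-- The local superoperator `Φ ⊗ id`, acting blockwise on matrices indexed by `S × T`:
`((Φ ⊗ id) M) (s,t) (s',t') = (Φ M^{(t,t')}) s s'` where `M^{(t,t')} s s' = M (s,t) (s',t')`. -/
def localSuper {S T : Type*} (Φ : Matrix S S ℂ → Matrix S S ℂ)
    (M : Matrix (S × T) (S × T) ℂ) : Matrix (S × T) (S × T) ℂ :=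
  Matrix.of fun p q => Φ (Matrix.of fun s s' => M (s, p.2) (s', q.2)) p.1 q.1

/-- The outer product of linear combinations is the combination of the outer products. -/
theorem outer_sum_smul {S T : Type*} [Fintype T] (a b : T → ℂ) (v : T → S → ℂ) :
    outer (fun s => ∑ t, a t * v t s) (fun s => ∑ t, b t * v t s) =
      ∑ t, ∑ t', (a t * (starRingEnd ℂ) (b t')) • outer (v t) (v t') := by
  ext s s'
  simp only [outer, Matrix.of_apply, map_sum, map_mul, Finset.sum_mul_sum, Matrix.sum_apply,
    Matrix.smul_apply, smul_eq_mul]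
  refine Finset.sum_congr rfl fun t _ => Finset.sum_congr rfl fun t' _ => ?_
  ring

/-- Pairing a Schmidt decomposition with one of its orthonormal factors recovers the other. -/
theorem schmidt_factor_eq_sum {S T J : Type*} [Fintype T] [Fintype J] [DecidableEq J]
    (φ : J → S → ℂ) (χ : J → T → ℂ) (c : J → ℂ)
    (hχ : ∀ j k, ∑ t, (starRingEnd ℂ) (χ j t) * χ k t = if j = k then 1 else 0)
    (hc : ∀ j, c j ≠ 0) (ψ : S × T → ℂ)
    (hψ : ∀ p : S × T, ψ p = ∑ j, c j * φ j p.1 * χ j p.2) (j : J) :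
    φ j = fun s => ∑ t, ((c j)⁻¹ * (starRingEnd ℂ) (χ j t)) * ψ (s, t) := by
  funext s
  symm
  calc ∑ t, ((c j)⁻¹ * (starRingEnd ℂ) (χ j t)) * ψ (s, t)
      = ∑ k, (c j)⁻¹ * (c k * φ k s) * ∑ t, (starRingEnd ℂ) (χ j t) * χ k t := by
        simp only [hψ, Finset.mul_sum]
        rw [Finset.sum_comm]
        refine Finset.sum_congr rfl fun k _ => Finset.sum_congr rfl fun t _ => ?_
        ring
    _ = φ j s := by
        simp [hχ, hc j]

theorem stmt0 {S T J : Type*} [Fintype S] [Fintype T] [Fintype J] [DecidableEq J]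
    [Nonempty S] [Nonempty T] [Nonempty J]
    (φ : J → S → ℂ) (χ : J → T → ℂ) (c : J → ℂ)
    (hφ : ∀ j k, ∑ s, (starRingEnd ℂ) (φ j s) * φ k s = if j = k then 1 else 0)
    (hχ : ∀ j k, ∑ t, (starRingEnd ℂ) (χ j t) * χ k t = if j = k then 1 else 0)
    (hc : ∀ j, c j ≠ 0)
    (ψ : S × T → ℂ)
    (hψ : ∀ p : S × T, ψ p = ∑ j, c j * φ j p.1 * χ j p.2)
    (Φ : Matrix S S ℂ →ₗ[ℂ] Matrix S S ℂ)
    (hΦ : localSuper (⇑Φ) (outer ψ ψ) = outer ψ ψ) :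
    ∀ j k, Φ (outer (φ j) (φ k)) = outer (φ j) (φ k) := by
  have hblock (t t' : T) : Φ (outer (fun s => ψ (s, t)) (fun s => ψ (s, t'))) =
      outer (fun s => ψ (s, t)) (fun s => ψ (s, t')) := by
    ext s s'
    exact congrFun (congrFun hΦ (s, t)) (s', t')
  intro j k
  rw [schmidt_factor_eq_sum φ χ c hχ hc ψ hψ j, schmidt_factor_eq_sum φ χ c hχ hc ψ hψ k,
    outer_sum_smul _ _ (fun t s => ψ (s, t))]
  simp only [map_sum, map_smul, hblock]
end
end

section
/- Let S, T be finite nonempty index types with |S| ≤ |T|, and let ψ ∈ ℂ^{S×T} be a unit vector of full Schmidt rank, i.e. the S × T complex matrix with entries (s,t) ↦ ψ(s,t) has rank |S|. Let Φ be a quantum channel on S × S complex matrices given by finitely many Kraus operators K_i with Φ(X) = Σ_i K_i X K_iᴴ and Σ_i K_iᴴ K_i = 1, and let ρ be a density matrix on ℂ^{S×T} with (Φ ⊗ id)(ρ) = ψ ψᴴ. Then there exists a unitary S × S matrix U such that ρ = φ φᴴ where φ = (Uᴴ ⊗ 1)ψ (i.e. φ(s,t) = Σ_{s'} conj(U_{s',s})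 ψ(s',t)), and Φ(X) = U X Uᴴ for every S × S matrix X. -/
open Matrix ComplexOrder

noncomputable section

open scoped MatrixOrder Matrix.Norms.L2Operator in
/-- A positive semidefinite matrix factors as `B * Bᴴ`. -/
theorem exists_eq_mul_conjTranspose_of_posSemidef {n : Type*} [Fintype n] {A : Matrix n n ℂ}
    (hA : A.PosSemidef) : ∃ B : Matrix n n ℂ, A = B * Bᴴ := by
  classical
  obtain ⟨C, hC⟩ := CStarAlgebra.nonneg_iff_eq_star_mul_self.1 hA.nonneg
  exact ⟨Cᴴ, by rw [hC, Matrix.conjTranspose_conjTranspose, Matrix.star_eq_conjTranspose]⟩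

/-- A finite family of vectors whose outer products sum to `outer ψ ψ` is proportional to `ψ`. -/
theorem eq_smul_of_sum_outer_eq {P κ : Type*} [Fintype κ] (v : κ → P → ℂ) (ψ : P → ℂ)
    (h : ∑ k, outer (v k) (v k) = outer ψ ψ) {p₀ : P} (hp₀ : ψ p₀ ≠ 0) (k : κ) :
    v k = (v k p₀ / ψ p₀) • ψ := by
  have G : ∀ p q, ∑ k, v k p * (starRingEnd ℂ) (v k q) = ψ p * (starRingEnd ℂ) (ψ q) := by
    intro p q
    simpa [outer, Matrix.sum_apply] using congrFun (congrFun h p) q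
  funext p
  have hsum : ∑ k, (ψ p₀ * v k p - ψ p * v k p₀) *
      (starRingEnd ℂ) (ψ p₀ * v k p - ψ p * v k p₀) = 0 := by
    have expand : ∀ k, (ψ p₀ * v k p - ψ p * v k p₀) *
        (starRingEnd ℂ) (ψ p₀ * v k p - ψ p * v k p₀) =
        ψ p₀ * (starRingEnd ℂ) (ψ p₀) * (v k p * (starRingEnd ℂ) (v k p))
        - ψ p₀ * (starRingEnd ℂ) (ψ p) * (v k p * (starRingEnd ℂ) (v k p₀))
        - ψ p * (starRingEnd ℂ) (ψ p₀) * (v k p₀ * (starRingEnd ℂ) (v k p))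
        + ψ p * (starRingEnd ℂ) (ψ p) * (v k p₀ * (starRingEnd ℂ) (v k p₀)) := by
      intro k
      simp only [map_sub, map_mul]
      ring
    simp only [expand, Finset.sum_add_distrib, Finset.sum_sub_distrib, ← Finset.mul_sum, G]
    ring
  have hnorm : ∑ k, Complex.normSq (ψ p₀ * v k p - ψ p * v k p₀) = 0 := by
    simp only [Complex.mul_conj] at hsum
    exact_mod_cast hsum
  have hk := (Finset.sum_eq_zero_iff_of_nonneg
    (fun k _ => Complex.normSq_nonneg _)).1 hnorm k (Finset.mem_univ k)
  have hk' := sub_eq_zero.1 (Complex.normSq_eq_zero.1 hk)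
  simp only [Pi.smul_apply, smul_eq_mul]
  field_simp
  linear_combination hk'

/-- A matrix of full row rank has a right inverse. -/
theorem exists_mul_eq_one_of_rank_eq_card {S T : Type*} [Fintype S] [Fintype T] [DecidableEq S]
    (M : Matrix S T ℂ) (h : M.rank = Fintype.card S) : ∃ N : Matrix T S ℂ, M * N = 1 := by
  classical
  rw [← Matrix.mulVec_surjective_iff_exists_right_inverse]
  have htop : LinearMap.range M.mulVecLin = ⊤ :=
    Submodule.eq_top_of_finrank_eq (by rw [← Matrix.rank, h, Module.finrank_fintype_fun_eq_card])
  exact LinearMap.range_eq_top.1 htop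

/-- Kraus operators that all map a common matrix to multiples of a matrix of full row rank, not all
zero, are proportional to one of them. -/
theorem eq_smul_of_mul_eq_smul {S T ι : Type*} [Fintype S] [Fintype T]
    [DecidableEq S] (K : ι → Matrix S S ℂ) (B M : Matrix S T ℂ) (N : Matrix T S ℂ)
    (hMN : M * N = 1) (c : ι → ℂ) (h : ∀ i, K i * B = c i • M) {i₀ : ι} (hi₀ : c i₀ ≠ 0) (i : ι) :
    K i = (c i / c i₀) • K i₀ := by
  have hN : ∀ i, K i * (B * N) = c i • (1 : Matrix S S ℂ) := fun i => by
    rw [← Matrix.mul_assoc, h, Matrix.smul_mul, hMN]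
  have hR : K i₀ * ((c i₀)⁻¹ • (B * N)) = 1 := by
    rw [Matrix.mul_smul, hN, smul_smul, inv_mul_cancel₀ hi₀, one_smul]
  have hL := mul_eq_one_comm.1 hR
  calc K i = K i * (((c i₀)⁻¹ • (B * N)) * K i₀) := by rw [hL, Matrix.mul_one]
    _ = (c i / c i₀) • K i₀ := by
      rw [← Matrix.mul_assoc, Matrix.mul_smul, hN, smul_smul, Matrix.smul_mul, Matrix.one_mul,
        mul_comm, div_eq_mul_inv]

/-- A channel whose Kraus operators are all proportional to one of them is a unitary conjugation. -/
theorem exists_unitary_of_kraus_eq_smul {S ι : Type*} [Fintype S] [DecidableEq S] [Nonempty S]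
    [Fintype ι] (K : ι → Matrix S S ℂ) (hK : ∑ i, (K i)ᴴ * K i = 1) (A : Matrix S S ℂ) (a : ι → ℂ)
    (h : ∀ i, K i = a i • A) :
    ∃ U : Matrix S S ℂ, Uᴴ * U = 1 ∧ U * Uᴴ = 1 ∧
      ∀ X : Matrix S S ℂ, ∑ i, K i * X * (K i)ᴴ = U * X * Uᴴ := by
  set r : ℝ := ∑ i, Complex.normSq (a i) with hr
  have hr0 : 0 ≤ r := Finset.sum_nonneg fun i _ => Complex.normSq_nonneg _
  have hrc : (r : ℂ) = ∑ i, a i * star (a i) := by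
    rw [hr, Complex.ofReal_sum]
    exact Finset.sum_congr rfl fun i _ => (Complex.mul_conj (a i)).symm
  have hs : ((√r : ℝ) : ℂ) * ((√r : ℝ) : ℂ) = r := by
    rw [← Complex.ofReal_mul, Real.mul_self_sqrt hr0]
  have hstar : star ((√r : ℝ) : ℂ) = ((√r : ℝ) : ℂ) := Complex.conj_ofReal _
  have hU : (((√r : ℝ) : ℂ) • A)ᴴ * (((√r : ℝ) : ℂ) • A) = 1 := by
    rw [Matrix.conjTranspose_smul, hstar, Matrix.smul_mul, Matrix.mul_smul, smul_smul, hs, hrc,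
      Finset.sum_smul, ← hK]
    refine Finset.sum_congr rfl fun i _ => ?_
    rw [h i, Matrix.conjTranspose_smul, Matrix.smul_mul, Matrix.mul_smul, smul_smul,
      mul_comm (a i)]
  refine ⟨((√r : ℝ) : ℂ) • A, hU, mul_eq_one_comm.1 hU, fun X => ?_⟩
  rw [Matrix.conjTranspose_smul, hstar, Matrix.smul_mul, Matrix.smul_mul, Matrix.mul_smul,
    smul_smul, hs, hrc, Finset.sum_smul]
  refine Finset.sum_congr rfl fun i _ => ?_
  rw [h i, Matrix.conjTranspose_smul, Matrix.smul_mul, Matrix.smul_mul, Matrix.mul_smul, smul_smul]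

/-- The local action of a Kraus channel on `B * Bᴴ` is the sum of the outer products of the images
of the columns of `B`. -/
theorem localSuper_mul_conjTranspose {S T ι κ : Type*} [Fintype S] [Fintype ι] [Fintype κ]
    (K : ι → Matrix S S ℂ) (B : Matrix (S × T) κ ℂ) :
    localSuper (fun X => ∑ i, K i * X * (K i)ᴴ) (B * Bᴴ) =
      ∑ k : ι × κ, outer (fun p : S × T => (K k.1 * Matrix.of fun s t => B (s, t) k.2) p.1 p.2)
        (fun p : S × T => (K k.1 * Matrix.of fun s t => B (s, t) k.2) p.1 p.2) := by
  ext p q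
  simp only [localSuper, outer, Matrix.of_apply, Matrix.sum_apply, Fintype.sum_prod_type]
  refine Finset.sum_congr rfl fun i _ => ?_
  simp only [Matrix.mul_apply, Matrix.of_apply, Matrix.conjTranspose_apply, map_sum, map_mul,
    Finset.mul_sum, Finset.sum_mul, starRingEnd_apply]
  rw [Finset.sum_comm_cycle]
  refine Finset.sum_congr rfl fun j _ => ?_
  refine Finset.sum_congr rfl fun s _ => ?_
  refine Finset.sum_congr rfl fun s' _ => ?_
  ring

/-- A local unitary conjugation with value `outer ψ ψ` can be undone. -/
theorem eq_outer_of_localSuper_unitary {S T : Type*} [Fintype S] [DecidableEq S]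
    (U : Matrix S S ℂ) (hU : Uᴴ * U = 1) (ψ : S × T → ℂ) (ρ : Matrix (S × T) (S × T) ℂ)
    (h : localSuper (fun X => U * X * Uᴴ) ρ = outer ψ ψ) :
    ρ = outer (fun p : S × T => ∑ s', (starRingEnd ℂ) (U s' p.1) * ψ (s', p.2))
      (fun p : S × T => ∑ s', (starRingEnd ℂ) (U s' p.1) * ψ (s', p.2)) := by
  ext ⟨s, t⟩ ⟨s', t'⟩
  have hblock : U * (Matrix.of fun s s' => ρ (s, t) (s', t')) * Uᴴ =
      Matrix.of fun s s' => ψ (s, t) * (starRingEnd ℂ) (ψ (s', t')) := by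
    ext x y
    exact congrFun (congrFun h (x, t)) (y, t')
  have hback : (Matrix.of fun s s' => ρ (s, t) (s', t')) =
      Uᴴ * (Matrix.of fun s s' => ψ (s, t) * (starRingEnd ℂ) (ψ (s', t'))) * U := by
    rw [← hblock, Matrix.mul_assoc, Matrix.mul_assoc, hU, Matrix.mul_one, ← Matrix.mul_assoc, hU,
      Matrix.one_mul]
  have hentry := congrFun (congrFun hback s) s'
  simp only [Matrix.of_apply] at hentry
  rw [hentry]
  simp only [outer, Matrix.mul_apply, Matrix.of_apply, Matrix.conjTranspose_apply, map_sum,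
    map_mul, Finset.mul_sum, Finset.sum_mul, starRingEnd_apply, star_star]
  refine Finset.sum_congr rfl fun x _ => ?_
  refine Finset.sum_congr rfl fun y _ => ?_
  ring

theorem stmt2 {S T : Type*} [Fintype S] [Fintype T] [DecidableEq S]
    [Nonempty S] [Nonempty T]
    (hcard : Fintype.card S ≤ Fintype.card T)
    (ψ : S × T → ℂ)
    (hunit : ∑ p, (starRingEnd ℂ) (ψ p) * ψ p = 1)
    (hrank : (Matrix.of fun s t => ψ (s, t) : Matrix S T ℂ).rank = Fintype.card S)
    {ι : Type*} [Fintype ι] (K : ι → Matrix S S ℂ)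
    (hK : ∑ i, (K i)ᴴ * K i = 1)
    (Φ : Matrix S S ℂ → Matrix S S ℂ)
    (hΦ : ∀ X, Φ X = ∑ i, K i * X * (K i)ᴴ)
    (ρ : Matrix (S × T) (S × T) ℂ)
    (hρ : ρ.PosSemidef) (hρtr : ρ.trace = 1)
    (hsteer : localSuper Φ ρ = outer ψ ψ) :
    ∃ U : Matrix S S ℂ, Uᴴ * U = 1 ∧ U * Uᴴ = 1 ∧
      ρ = outer (fun p : S × T => ∑ s', (starRingEnd ℂ) (U s' p.1) * ψ (s', p.2))
            (fun p : S × T => ∑ s', (starRingEnd ℂ) (U s' p.1) * ψ (s', p.2)) ∧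
      ∀ X : Matrix S S ℂ, Φ X = U * X * Uᴴ := by
  classical
  obtain rfl : Φ = fun X => ∑ i, K i * X * (K i)ᴴ := funext hΦ
  obtain ⟨N, hN⟩ := exists_mul_eq_one_of_rank_eq_card _ hrank
  obtain ⟨p₀, hp₀⟩ : ∃ p, ψ p ≠ 0 := by
    by_contra! hzero
    simp [hzero] at hunit
  obtain ⟨B, hB⟩ := exists_eq_mul_conjTranspose_of_posSemidef hρ
  have hsum := hsteer
  rw [hB, localSuper_mul_conjTranspose] at hsum
  have hv := eq_smul_of_sum_outer_eq _ ψ hsum hp₀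
  obtain ⟨⟨i₀, j⟩, hk⟩ : ∃ k : ι × (S × T),
      (K k.1 * Matrix.of fun s t => B (s, t) k.2) p₀.1 p₀.2 ≠ 0 := by
    by_contra! hzero
    have hentry := congrFun (congrFun hsum p₀) p₀
    rw [Matrix.sum_apply] at hentry
    simp only [outer, Matrix.of_apply, hzero, zero_mul, Finset.sum_const_zero] at hentry
    exact mul_ne_zero hp₀ ((map_ne_zero _).2 hp₀) hentry.symm
  have hprop := eq_smul_of_mul_eq_smul K (Matrix.of fun s t => B (s, t) j) _ N hN
    (fun i => (K i * Matrix.of fun s t => B (s, t) j) p₀.1 p₀.2 / ψ p₀)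
    (fun i => by ext s t; exact congrFun (hv (i, j)) (s, t)) (i₀ := i₀) (div_ne_zero hk hp₀)
  obtain ⟨U, hU, hU', hconj⟩ := exists_unitary_of_kraus_eq_smul K hK (K i₀) _ hprop
  refine ⟨U, hU, hU', eq_outer_of_localSuper_unitary U hU ψ ρ ?_, hconj⟩
  rw [← hsteer]
  exact congrArg (fun F => localSuper F ρ) (funext hconj).symm
end
end

section
/- Let S, T be finite nonempty index types, let A be a Hermitian S × S complex matrix, let a, b be distinct complex numbers, and let v, w ∈ ℂ^{S×T} satisfy (A ⊗ 1)v = a•v and (A ⊗ 1)w = b•w, where A ⊗ 1 is the (S×T) × (S×T) matrix with entries (A ⊗ 1)_{(s,t),(s',t')} = A_{s,s'}·δ_{t,t'}. Then the partial trace over the first factor satisfies Tr_S(v wᴴ) = 0; consequently Tr_S((v+w)(v+w)ᴴ) = Tr_S((v−w)(v−w)ᴴ), i.e. the two superposition states have identical reduced matrices on the second factor. -/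
open Matrix

noncomputable section

/-- Partial trace over the first tensor factor. -/
def ptraceFst {S T : Type*} [Fintype S] (M : Matrix (S × T) (S × T) ℂ) :
    Matrix T T ℂ :=
  Matrix.of fun t t' => ∑ s, M (s, t) (s, t')

/-- `A ⊗ 1`, acting as `A` on the first factor of `S × T`. -/
def kronIdRight {S T : Type*} [DecidableEq T] (A : Matrix S S ℂ) :
    Matrix (S × T) (S × T) ℂ :=
  Matrix.of fun p q => A p.1 q.1 * (if p.2 = q.2 then 1 else 0)

/-- For a Hermitian matrix, the sesquilinear pairing of two eigenvectors intertwines the first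
eigenvalue with the conjugate of the second. -/
theorem Matrix.IsHermitian.mul_star_dotProduct {S : Type*} [Fintype S] {A : Matrix S S ℂ}
    (hA : A.IsHermitian) {a b : ℂ} {x y : S → ℂ} (hx : A *ᵥ x = a • x) (hy : A *ᵥ y = b • y) :
    a * (star y ⬝ᵥ x) = star b * (star y ⬝ᵥ x) := by
  have h : star y ⬝ᵥ (A *ᵥ x) = star (A *ᵥ y) ⬝ᵥ x := by
    rw [star_mulVec, hA.eq, dotProduct_mulVec]
  simpa [hx, hy] using h

/-- Eigenvectors of a Hermitian matrix for distinct eigenvalues are orthogonal. -/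
theorem Matrix.IsHermitian.star_dotProduct_eq_zero {S : Type*} [Fintype S] {A : Matrix S S ℂ}
    (hA : A.IsHermitian) {a b : ℂ} (hab : a ≠ b) {x y : S → ℂ}
    (hx : A *ᵥ x = a • x) (hy : A *ᵥ y = b • y) : star y ⬝ᵥ x = 0 := by
  open scoped ComplexOrder in
  rcases mul_eq_mul_right_iff.mp (hA.mul_star_dotProduct hy hy) with hb | h0
  · rcases mul_eq_mul_right_iff.mp (hA.mul_star_dotProduct hx hy) with h | h
    · exact absurd (h.trans hb.symm) hab
    · exact h
  · simp [dotProduct_star_self_eq_zero.mp h0]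

theorem kronIdRight_mulVec_apply {S T : Type*} [Fintype S] [Fintype T] [DecidableEq T]
    (A : Matrix S S ℂ) (v : S × T → ℂ) (s : S) (t : T) :
    (kronIdRight A *ᵥ v) (s, t) = (A *ᵥ fun s' => v (s', t)) s := by
  simp [kronIdRight, mulVec, dotProduct, Fintype.sum_prod_type]

theorem mulVec_slice_of_kronIdRight_mulVec {S T : Type*} [Fintype S] [Fintype T] [DecidableEq T]
    {A : Matrix S S ℂ} {a : ℂ} {v : S × T → ℂ} (hv : kronIdRight A *ᵥ v = a • v) (t : T) :
    (A *ᵥ fun s => v (s, t)) = a • fun s => v (s, t) := by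
  ext s
  rw [← kronIdRight_mulVec_apply, hv]
  rfl

theorem ptraceFst_outer_apply {S T : Type*} [Fintype S] (v w : S × T → ℂ) (t t' : T) :
    ptraceFst (outer v w) t t' = (star fun s => w (s, t')) ⬝ᵥ fun s => v (s, t) := by
  simp [ptraceFst, outer, dotProduct, mul_comm]

theorem ptraceFst_outer_eq_zero {S T : Type*} [Fintype S] [Fintype T] [DecidableEq T]
    {A : Matrix S S ℂ} (hA : A.IsHermitian) {a b : ℂ} (hab : a ≠ b) {v w : S × T → ℂ}
    (hv : kronIdRight A *ᵥ v = a • v) (hw : kronIdRight A *ᵥ w = b • w) :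
    ptraceFst (outer v w) = 0 := by
  ext t t'
  rw [ptraceFst_outer_apply]
  exact hA.star_dotProduct_eq_zero hab (mulVec_slice_of_kronIdRight_mulVec hv t)
    (mulVec_slice_of_kronIdRight_mulVec hw t')

/-- Polarization: the reduced matrices of `v + w` and `v - w` differ by the cross terms. -/
theorem ptraceFst_outer_add_sub {S T : Type*} [Fintype S] (v w : S × T → ℂ) :
    ptraceFst (outer (v + w) (v + w)) = ptraceFst (outer (v - w) (v - w)) +
      (2 : ℂ) • (ptraceFst (outer v w) + ptraceFst (outer w v)) := by
  ext t t'
  simp only [ptraceFst, outer, Matrix.add_apply, Matrix.smul_apply, of_apply, Pi.add_apply,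
    Pi.sub_apply, map_add, map_sub, smul_eq_mul, Finset.mul_sum, ← Finset.sum_add_distrib]
  exact Finset.sum_congr rfl fun s _ => by ring

theorem stmt6 {S T : Type*} [Fintype S] [Fintype T] [DecidableEq T]
    [Nonempty S] [Nonempty T]
    (A : Matrix S S ℂ) (hA : Aᴴ = A)
    (a b : ℂ) (hab : a ≠ b)
    (v w : S × T → ℂ)
    (hv : (kronIdRight A).mulVec v = a • v)
    (hw : (kronIdRight A).mulVec w = b • w) :
    ptraceFst (outer v w) = 0 ∧
    ptraceFst (outer (v + w) (v + w)) = ptraceFst (outer (v - w) (v - w)) := by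
  have hvw := ptraceFst_outer_eq_zero hA hab hv hw
  refine ⟨hvw, ?_⟩
  rw [ptraceFst_outer_add_sub, hvw, ptraceFst_outer_eq_zero hA hab.symm hw hv]
  simp
end
end

section
/- Let H and V be n × n complex matrices with H = Hᴴ, H² = 1, V = Vᴴ, V² = 1, and VH = −HV, and set Π = (1 − H)/2. Then: (a) the Kraus operators K₁ = Π and K₂ = ΠV satisfy the completeness relation K₁ᴴK₁ + K₂ᴴK₂ = 1, so X ↦ ΠXΠ + ΠV X VΠ is a trace-preserving quantum operation; and (b) the Heisenberg-picture image of H under this operation is the bottom of its spectrum: ΠHΠ + VΠHΠV = −1. In other words, the steering superoperator built from the local projection Π and the flip operator V cools the local term H to its ground value −1. -/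
open Matrix

noncomputable section

theorem stmt10 {n : ℕ} (H V : Matrix (Fin n) (Fin n) ℂ)
    (hH : Hᴴ = H) (hH2 : H * H = 1)
    (hV : Vᴴ = V) (hV2 : V * V = 1)
    (hVH : V * H = -(H * V))
    (Pr : Matrix (Fin n) (Fin n) ℂ) (hPr : Pr = (2 : ℂ)⁻¹ • (1 - H)) :
    Prᴴ * Pr + (Pr * V)ᴴ * (Pr * V) = 1 ∧
      Pr * H * Pr + V * Pr * H * Pr * V = -1 := by
  have adjoint : Prᴴ = Pr := by
    simp [hPr, conjTranspose_smul, hH]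
  have idem : Pr * Pr = Pr := by
    rw [hPr, smul_mul_smul_comm, mul_sub, sub_mul, sub_mul, hH2]
    simp only [one_mul, mul_one]
    module
  have ground : Pr * H = -Pr := by
    rw [hPr, smul_mul_assoc, sub_mul, hH2, one_mul]
    module
  have flip : V * Pr * V = (2 : ℂ)⁻¹ • (1 + H) := by
    rw [hPr, mul_smul_comm, smul_mul_assoc, mul_sub, sub_mul, hVH, mul_one, hV2,
      neg_mul, mul_assoc, hV2, mul_one, sub_neg_eq_add]
  have complete : Pr + V * Pr * V = 1 := by
    rw [flip, hPr]
    module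
  constructor
  · rw [conjTranspose_mul, adjoint, hV, idem, mul_assoc V, ← mul_assoc Pr, idem,
      ← mul_assoc, complete]
  · rw [mul_assoc V Pr H, ground, neg_mul, idem, mul_neg, neg_mul, neg_mul,
      mul_assoc V Pr Pr, idem, ← neg_add, complete]
end
end

section
/- Let H, H', V be n × n complex matrices with H = Hᴴ, H² = 1, V = Vᴴ, V² = 1, VH = −HV, HH' = H'H, and VH' = −H'V, and set Π = (1 − H)/2. Then the Heisenberg-picture image of H' under the steering operation with Kraus operators Π and ΠV is ΠH'Π + VΠH'ΠV = −H'·H; i.e. under the local cooling superoperator for H, every commuting term H' that anticommutes with the flip operator V is mapped to (minus) its product with H inside the Hamiltonian group. -/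
open Matrix

noncomputable section

theorem stmt11 {n : ℕ} (H H' V : Matrix (Fin n) (Fin n) ℂ)
    (hH : Hᴴ = H) (hH2 : H * H = 1)
    (hV : Vᴴ = V) (hV2 : V * V = 1)
    (hVH : V * H = -(H * V))
    (hHH' : H * H' = H' * H)
    (hVH' : V * H' = -(H' * V))
    (Pr : Matrix (Fin n) (Fin n) ℂ) (hPr : Pr = (2 : ℂ)⁻¹ • (1 - H)) :
    Pr * H' * Pr + V * Pr * H' * Pr * V = -(H' * H) := by
  have hPrH' : Pr * H' * Pr = (2 : ℂ)⁻¹ • (H' - H' * H) := by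
    have hHH'H : H * H' * H = H' := by rw [hHH', mul_assoc, hH2, mul_one]
    have hexp : (1 - H) * H' * (1 - H) = (2 : ℂ) • (H' - H' * H) := by
      rw [sub_mul, one_mul, mul_sub, mul_one, sub_mul, hHH'H, hHH', two_smul]
      abel
    rw [hPr, smul_mul_assoc, smul_mul_assoc, mul_smul_comm, hexp,
      inv_smul_smul₀ two_ne_zero]
  have hVH'V : V * H' * V = -H' := by
    rw [hVH', neg_mul, mul_assoc, hV2, mul_one]
  have hVH'HV : V * (H' * H) * V = H' * H := by
    rw [← mul_assoc V, hVH', neg_mul, mul_assoc H', hVH, mul_neg, neg_neg, ← mul_assoc,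
      mul_assoc _ V V, hV2, mul_one]
  have hassoc : V * Pr * H' * Pr * V = V * (Pr * H' * Pr) * V := by
    simp only [mul_assoc]
  rw [hassoc, hPrH', mul_smul_comm, smul_mul_assoc, mul_sub, sub_mul, hVH'V, hVH'HV,
    ← smul_add]
  have hsum : H' - H' * H + (-H' - H' * H) = (2 : ℂ) • -(H' * H) := by
    rw [two_smul]
    abel
  rw [hsum, inv_smul_smul₀ two_ne_zero]
end
end

section
/- Let H and V be n × n complex matrices with H = Hᴴ, H² = 1, V = Vᴴ, V² = 1, and VH = −HV, and set Π₋ = (1 − H)/2 and Π₊ = (1 + H)/2. Then the (2n) × (2n) block matrix U = [[Π₋, Π₊],[Π₋V, Π₊V]] (equivalently U = |0⟩⟨0| ⊗ Π₋ + |0⟩⟨1| ⊗ Π₊ + |1⟩⟨0| ⊗ Π₋V + |1⟩⟨1| ⊗ Π₊V on ℂ² ⊗ ℂⁿ) is unitary: UᴴU = UUᴴ = 1. Moreover its first block column gives the Kraus operators ⟨0|U|0⟩ = Π₋ and ⟨1|U|0⟩ = Π₋V of the steering superoperator, realizing it as a unitary dilation with an auxiliary qubit initialized in |0⟩. -/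
open Matrix

noncomputable section

/-- The block matrix `[[A, B], [C, D]]` on `ℂ² ⊗ ℂⁿ`. -/
def blockMat2 {n : ℕ} (A B C D : Matrix (Fin n) (Fin n) ℂ) :
    Matrix (Fin 2 × Fin n) (Fin 2 × Fin n) ℂ :=
  Matrix.of fun p q =>
    if p.1 = 0 then (if q.1 = 0 then A p.2 q.2 else B p.2 q.2)
    else (if q.1 = 0 then C p.2 q.2 else D p.2 q.2)

theorem blockMat2_mul {n : ℕ} (A B C D A' B' C' D' : Matrix (Fin n) (Fin n) ℂ) :
    blockMat2 A B C D * blockMat2 A' B' C' D' =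
      blockMat2 (A * A' + B * C') (A * B' + B * D') (C * A' + D * C') (C * B' + D * D') := by
  ext ⟨i, s⟩ ⟨j, t⟩
  fin_cases i <;> fin_cases j <;>
    simp [blockMat2, Matrix.mul_apply, Fintype.sum_prod_type, Fin.sum_univ_two]

theorem blockMat2_conjTranspose {n : ℕ} (A B C D : Matrix (Fin n) (Fin n) ℂ) :
    (blockMat2 A B C D)ᴴ = blockMat2 Aᴴ Cᴴ Bᴴ Dᴴ := by
  ext ⟨i, s⟩ ⟨j, t⟩
  fin_cases i <;> fin_cases j <;> simp [blockMat2, Matrix.conjTranspose_apply]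

theorem blockMat2_one {n : ℕ} :
    blockMat2 (1 : Matrix (Fin n) (Fin n) ℂ) 0 0 1 = 1 := by
  ext ⟨i, s⟩ ⟨j, t⟩
  fin_cases i <;> fin_cases j <;> simp [blockMat2, Matrix.one_apply]

theorem stmt12 {n : ℕ} (H V : Matrix (Fin n) (Fin n) ℂ)
    (hH : Hᴴ = H) (hH2 : H * H = 1)
    (hV : Vᴴ = V) (hV2 : V * V = 1)
    (hVH : V * H = -(H * V))
    (Pm Pp : Matrix (Fin n) (Fin n) ℂ)
    (hPm : Pm = (2 : ℂ)⁻¹ • (1 - H)) (hPp : Pp = (2 : ℂ)⁻¹ • (1 + H))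
    (U : Matrix (Fin 2 × Fin n) (Fin 2 × Fin n) ℂ)
    (hU : U = blockMat2 Pm Pp (Pm * V) (Pp * V)) :
    Uᴴ * U = 1 ∧ U * Uᴴ = 1 ∧
      (Matrix.of fun s s' => U (0, s) (0, s')) = Pm ∧
      (Matrix.of fun s s' => U (1, s) (0, s')) = Pm * V := by
  have hPmH : Pmᴴ = Pm := by
    rw [hPm, conjTranspose_smul, conjTranspose_sub, conjTranspose_one, hH]; simp
  have hPpH : Ppᴴ = Pp := by
    rw [hPp, conjTranspose_smul, conjTranspose_add, conjTranspose_one, hH]; simp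
  have hsq : Pm * Pm + Pp * Pp = 1 := by
    subst hPm hPp
    simp only [smul_mul_smul_comm, mul_add, add_mul, mul_sub, sub_mul, hH2, mul_one, one_mul]
    module
  have hPmPp : Pm * Pp = 0 := by
    subst hPm hPp
    simp only [smul_mul_smul_comm, mul_add, sub_mul, hH2, mul_one, one_mul]
    module
  have hPpPm : Pp * Pm = 0 := by
    subst hPm hPp
    simp only [smul_mul_smul_comm, add_mul, mul_sub, hH2, mul_one, one_mul]
    module
  have hVPm : V * Pm = Pp * V := by
    rw [hPm, hPp, mul_smul_comm, smul_mul_assoc, mul_sub, add_mul, hVH, mul_one, one_mul,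
      sub_neg_eq_add]
  have hVPp : V * Pp = Pm * V := by
    rw [hPm, hPp, mul_smul_comm, smul_mul_assoc, mul_add, sub_mul, hVH, mul_one, one_mul,
      sub_eq_add_neg]
  have hUU : U * Uᴴ = 1 := by
    rw [hU, blockMat2_conjTranspose, blockMat2_mul, ← blockMat2_one]
    simp only [conjTranspose_mul, hPmH, hPpH, hV, hVPm, hVPp]
    congr 1
    · simp [← mul_assoc, hPmPp, hPpPm]
    · simp [mul_assoc, hVPm, hVPp, ← mul_assoc Pm Pp, ← mul_assoc Pp Pm, hPmPp, hPpPm]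
    · rw [mul_assoc Pm, ← mul_assoc V, hVPp, mul_assoc Pp, ← mul_assoc V, hVPm]
      simp only [mul_assoc, hV2, mul_one, hsq]
  refine ⟨mul_eq_one_comm.mp hUU, hUU, ?_, ?_⟩ <;> ext s t <;> simp [hU, blockMat2]
end
end

section
/- Let N be an odd natural number with N ≥ 3 and let s : ZMod N → ℤ be a spin configuration with s(i) = 1 or s(i) = −1 for every i. Then the antiferromagnetic Ising energy on the ring satisfies Σ_{i ∈ ZMod N} s(i)·s(i+1) ≥ 2 − N, and this bound is attained: there exists such a configuration s with Σ_{i ∈ ZMod N} s(i)·s(i+1) = 2 − N. In other words, the one-dimensional antiferromagnetic Ising model with periodic boundary conditions and an odd number of spins is geometrically frustrated, with ground-state energy 2 − N in which exactly one bond is unsatisfied. -/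
noncomputable section

/-- Around a ring every spin occurs in exactly two bonds, so the product of all bonds is `1`. -/
theorem prod_bond_eq_one {N : ℕ} [NeZero N] (s : ZMod N → ℤ) (hs : ∀ i, s i = 1 ∨ s i = -1) :
    ∏ i : ZMod N, s i * s (i + 1) = 1 := by
  have hshift : ∏ i : ZMod N, s (i + 1) = ∏ i, s i :=
    Equiv.prod_comp (Equiv.addRight (1 : ZMod N)) s
  rw [Finset.prod_mul_distrib, hshift, ← Finset.prod_mul_distrib]
  exact Finset.prod_eq_one fun i _ => by rcases hs i with h | h <;> simp [h]

theorem bond_eq_one_or_neg_one {N : ℕ} (s : ZMod N → ℤ) (hs : ∀ i, s i = 1 ∨ s i = -1)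
    (i : ZMod N) : s i * s (i + 1) = 1 ∨ s i * s (i + 1) = -1 := by
  rcases hs i with h | h <;> rcases hs (i + 1) with hb | hb <;> simp [h, hb]

/-- On a ring of odd length at least one bond is unsatisfied. -/
theorem exists_bond_eq_one {N : ℕ} [NeZero N] (hodd : Odd N) (s : ZMod N → ℤ)
    (hs : ∀ i, s i = 1 ∨ s i = -1) : ∃ i, s i * s (i + 1) = 1 := by
  by_contra! h
  have hprod := prod_bond_eq_one s hs
  rw [Finset.prod_congr rfl fun i _ => (bond_eq_one_or_neg_one s hs i).resolve_left (h i)] at hprod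
  simp [ZMod.card, hodd.neg_one_pow] at hprod

theorem sum_ite_eq_two_sub {N : ℕ} [NeZero N] (j : ZMod N) :
    ∑ i : ZMod N, (if i = j then (1 : ℤ) else -1) = 2 - N := by
  have h (i : ZMod N) : (if i = j then (1 : ℤ) else -1) = (if i = j then 2 else 0) - 1 := by
    split_ifs <;> norm_num
  simp [h, Finset.sum_sub_distrib, ZMod.card]

/-- In the alternating configuration only the bond closing the ring is unsatisfied. -/
theorem alternating_bond {N : ℕ} [NeZero N] (hodd : Odd N) (i : ZMod N) :
    (-1 : ℤ) ^ i.val * (-1) ^ (i + 1).val = if i = -1 then 1 else -1 := by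
  obtain ⟨k, rfl⟩ := hodd
  split_ifs with h
  · subst h
    simp [ZMod.val_neg_one]
  · have hval : (i + 1).val = i.val + 1 := by
      have hlt := ZMod.val_lt i
      have hne : i.val ≠ 2 * k := fun hi => h <| ZMod.val_injective _ <| by
        rw [hi, ZMod.val_neg_one]
      have hone : (1 : ZMod (2 * k + 1)).val = 1 := ZMod.val_one'' (by omega)
      rw [ZMod.val_add_of_lt (by omega), hone]
    rw [hval, pow_succ, ← mul_assoc, ← mul_pow]
    simp

theorem stmt13 (N : ℕ) [NeZero N] (hN : 3 ≤ N) (hodd : Odd N) :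
    (∀ s : ZMod N → ℤ, (∀ i, s i = 1 ∨ s i = -1) →
        2 - (N : ℤ) ≤ ∑ i : ZMod N, s i * s (i + 1)) ∧
      ∃ s : ZMod N → ℤ, (∀ i, s i = 1 ∨ s i = -1) ∧
        ∑ i : ZMod N, s i * s (i + 1) = 2 - (N : ℤ) := by
  constructor
  · intro s hs
    obtain ⟨j, hj⟩ := exists_bond_eq_one hodd s hs
    rw [← sum_ite_eq_two_sub j]
    refine Finset.sum_le_sum fun i _ => ?_
    split_ifs with h
    · rw [h, hj]
    · rcases bond_eq_one_or_neg_one s hs i with hb | hb <;> simp [hb]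
  · refine ⟨fun i => (-1) ^ i.val, fun i => neg_one_pow_eq_or ℤ i.val, ?_⟩
    simp_rw [alternating_bond hodd]
    exact sum_ite_eq_two_sub (-1)
end
end
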